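/- arXiv:1207.5686 — 4 statements merged into one kernel-verified Lean document; each statement's English description precedes it below -/
import Mathlib

section
/- Let θ : ℝ → ℂ be measurable with ∫_ℝ |θ(x)| e^{β|x|/2} dx < ∞, and set θ̂(z) = ∫_ℝ θ(x) e^{−izx} dx for z ∈ ℂ with |Im z| ≤ β/2. Then for every f ∈ ℰ the convolution θ*f belongs to ℰ and ‖θ*f‖_ω ≤ (sup_{|Im z| ≤ β/2} |θ̂(z)|) · ‖f‖_ω; in particular, the convolution operator Θ : f ↦ θ*f is a bounded linear operator on ℰ. -/
open MeasureTheory Complex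

/-- Membership in `ℰ = L²(ℝ, cosh(βx) dx)`. -/
def memE (β : ℝ) (f : ℝ → ℂ) : Prop :=
  AEStronglyMeasurable f volume ∧
    Integrable (fun x : ℝ => ‖f x‖ ^ 2 * Real.cosh (β * x))

/-- The norm `‖f‖_ω = (∫ |f|² cosh(βx) dx)^{1/2}`. -/
noncomputable def normE (β : ℝ) (f : ℝ → ℂ) : ℝ :=
  Real.sqrt (∫ x : ℝ, ‖f x‖ ^ 2 * Real.cosh (β * x))

/-- The convolution `(θ * f)(x) = ∫ θ(x−y) f(y) dy`. -/
noncomputable def conv (θ f : ℝ → ℂ) (x : ℝ) : ℂ := ∫ y : ℝ, θ (x - y) * f y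

/-- The Fourier transform `θ̂(z) = ∫ θ(x) e^{−izx} dx` for complex `z`. -/
noncomputable def FTc (θ : ℝ → ℂ) (z : ℂ) : ℂ :=
  ∫ x : ℝ, θ x * Complex.exp (-(Complex.I * z * x))

open scoped ENNReal FourierTransform Convolution SchwartzMap

theorem lintegral_sq_lconvolution_le {a b : ℝ → ℝ≥0∞} (ha : AEMeasurable a) (hb : AEMeasurable b) :
    ∫⁻ x, (∫⁻ y, a (x - y) * b y) ^ 2 ≤ (∫⁻ x, a x) ^ 2 * ∫⁻ y, b y ^ 2 := by
  have hsub (x : ℝ) : AEMeasurable fun y ↦ a (x - y) :=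
    ha.comp_quasiMeasurePreserving (quasiMeasurePreserving_sub_left volume x)
  have hprod : AEMeasurable (fun p : ℝ × ℝ ↦ a (p.1 - p.2)) (volume.prod volume) :=
    ha.comp_quasiMeasurePreserving (quasiMeasurePreserving_sub volume volume)
  have hsqrt (t : ℝ≥0∞) : (t ^ (1 / 2 : ℝ)) ^ 2 = t := by
    rw [← ENNReal.rpow_natCast, ← ENNReal.rpow_mul]; norm_num
  have hcs (x : ℝ) :
      (∫⁻ y, a (x - y) * b y) ^ 2 ≤ (∫⁻ y, a y) * ∫⁻ y, a (x - y) * b y ^ 2 := by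
    have h := ENNReal.lintegral_mul_le_Lp_mul_Lq volume Real.HolderConjugate.two_two
      ((hsub x).pow_const (1 / 2 : ℝ)) (((hsub x).pow_const (1 / 2 : ℝ)).mul hb)
    simp only [Pi.mul_apply, ← mul_assoc, ← pow_two, ENNReal.rpow_two, mul_pow, hsqrt] at h
    grw [h, mul_pow, hsqrt, hsqrt, lintegral_sub_left_eq_self a x]
  calc
    _ ≤ ∫⁻ x, (∫⁻ y, a y) * ∫⁻ y, a (x - y) * b y ^ 2 := lintegral_mono hcs
    _ = (∫⁻ y, a y) * ∫⁻ x, ∫⁻ y, a (x - y) * b y ^ 2 := by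
      refine lintegral_const_mul'' _ ?_
      exact (hprod.mul ((hb.pow_const 2).comp_quasiMeasurePreserving
        Measure.quasiMeasurePreserving_snd)).lintegral_prod_right'
    _ = (∫⁻ y, a y) * ∫⁻ y, ∫⁻ x, a (x - y) * b y ^ 2 := by
      rw [lintegral_lintegral_swap]
      exact hprod.mul ((hb.pow_const 2).comp_quasiMeasurePreserving
        Measure.quasiMeasurePreserving_snd)
    _ = (∫⁻ x, a x) ^ 2 * ∫⁻ y, b y ^ 2 := by
      have (y : ℝ) : ∫⁻ x, a (x - y) * b y ^ 2 = (∫⁻ x, a x) * b y ^ 2 := by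
        rw [lintegral_mul_const'', lintegral_sub_right_eq_self a y]
        exact ha.comp_quasiMeasurePreserving
          (measurePreserving_sub_right volume y).quasiMeasurePreserving
      simp_rw [this]
      rw [lintegral_const_mul'' _ (hb.pow_const 2), ← mul_assoc, pow_two]

theorem eLpNorm_two_sq (f : ℝ → ℂ) : eLpNorm f 2 ^ 2 = ∫⁻ x, ‖f x‖ₑ ^ 2 := by
  simpa using eLpNorm_nnreal_pow_eq_lintegral (f := f) (p := 2) (μ := volume) (by norm_num)

theorem aestronglyMeasurable_conv_integrand {φ g : ℝ → ℂ} (hφ : AEStronglyMeasurable φ)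
    (hg : AEStronglyMeasurable g) :
    AEStronglyMeasurable (fun p : ℝ × ℝ ↦ φ (p.1 - p.2) * g p.2) (volume.prod volume) :=
  (hφ.comp_quasiMeasurePreserving (quasiMeasurePreserving_sub volume volume)).mul hg.comp_snd

theorem conv_eq_convolution (φ g : ℝ → ℂ) :
    conv φ g = φ ⋆[ContinuousLinearMap.mul ℂ ℂ] g := by
  ext x
  simp [convolution_eq_swap, conv]

theorem eLpNorm_conv_le {φ g : ℝ → ℂ} (hφ : AEStronglyMeasurable φ)
    (hg : AEStronglyMeasurable g) :
    eLpNorm (conv φ g) 2 ≤ eLpNorm φ 1 * eLpNorm g 2 := by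
  rw [← ENNReal.pow_le_pow_left_iff two_ne_zero, mul_pow, eLpNorm_two_sq, eLpNorm_two_sq,
    eLpNorm_one_eq_lintegral_enorm]
  refine le_trans (lintegral_mono fun x ↦ ?_) (lintegral_sq_lconvolution_le hφ.enorm hg.enorm)
  gcongr
  simpa [conv] using enorm_integral_le_lintegral_enorm fun y ↦ φ (x - y) * g y

theorem memLp_conv {φ g : ℝ → ℂ} (hφ : Integrable φ) (hg : MemLp g 2) : MemLp (conv φ g) 2 :=
  ⟨(aestronglyMeasurable_conv_integrand hφ.1 hg.1).integral_prod_right',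
    (eLpNorm_conv_le hφ.1 hg.1).trans_lt
      (ENNReal.mul_lt_top (memLp_one_iff_integrable.2 hφ).2 hg.2)⟩

theorem ae_integrable_conv_integrand {φ g : ℝ → ℂ} (hφ : Integrable φ) (hg : MemLp g 2) :
    ∀ᵐ x, Integrable fun y ↦ φ (x - y) * g y := by
  have hm := aestronglyMeasurable_conv_integrand hφ.1 hg.1
  have hfin : ∫⁻ x, (∫⁻ y, ‖φ (x - y)‖ₑ * ‖g y‖ₑ) ^ 2 ≠ ∞ := by
    refine ne_top_of_le_ne_top ?_ (lintegral_sq_lconvolution_le hφ.1.enorm hg.1.enorm)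
    rw [← eLpNorm_two_sq]
    exact ENNReal.mul_ne_top (ENNReal.pow_ne_top hφ.2.ne) (ENNReal.pow_ne_top hg.2.ne)
  have hlt := ae_lt_top' (by simpa using (hm.enorm.lintegral_prod_right').pow_const 2) hfin
  filter_upwards [hlt, hm.prodMk_left] with x hx hxm
  exact ⟨hxm, by simpa [hasFiniteIntegral_iff_enorm] using hx⟩

theorem conv_sub_ae {φ g h : ℝ → ℂ} (hφ : Integrable φ) (hg : MemLp g 2) (hh : MemLp h 2) :
    conv φ (g - h) =ᵐ[volume] conv φ g - conv φ h := by
  filter_upwards [ae_integrable_conv_integrand hφ hg, ae_integrable_conv_integrand hφ hh]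
    with x hx hx'
  simp [conv, mul_sub, integral_sub hx hx']

theorem eLpNorm_le_of_forall_schwartz {u : ℝ → ℂ} (hu : MemLp u 2) {C : ℝ} (hC : 0 ≤ C)
    (h : ∀ s : 𝓢(ℝ, ℂ), ‖∫ x, u x * s x‖ ≤ C * ‖s.toLp 2‖) :
    eLpNorm u 2 ≤ ENNReal.ofReal C := by
  set U : Lp ℂ 2 (volume : Measure ℝ) := hu.star.toLp (star u) with hU
  have key (H : Lp ℂ 2 (volume : Measure ℝ)) : ‖inner ℂ U H‖ ≤ C * ‖H‖ := by
    refine (SchwartzMap.denseRange_toLpCLM (E := ℝ) (F := ℂ) (p := 2)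
      ENNReal.ofNat_ne_top).induction_on
      (p := fun H ↦ ‖inner ℂ U H‖ ≤ C * ‖H‖) H
      (isClosed_le (by fun_prop) (by fun_prop)) fun s ↦ ?_
    change ‖inner ℂ U (s.toLp 2)‖ ≤ C * ‖s.toLp 2‖
    convert h s using 2
    rw [L2.inner_def]
    refine integral_congr_ae ?_
    filter_upwards [hu.star.coeFn_toLp, s.coeFn_toLp 2] with x hx hx'
    rw [hx', hU, hx]
    simp [mul_comm]
  have hUC : ‖U‖ ≤ C := by
    have := key U
    rw [← inner_self_re_eq_norm, inner_self_eq_norm_mul_norm] at this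
    rcases (norm_nonneg U).eq_or_lt with h0 | h0
    · rwa [← h0]
    · exact le_of_mul_le_mul_right this h0
  rw [hU, Lp.norm_toLp, eLpNorm_star] at hUC
  exact (ENNReal.le_ofReal_iff_toReal_le hu.2.ne hC).2 hUC

theorem integral_conv_mul_fourier {φ g k : ℝ → ℂ} (hφ : Integrable φ) (hg : Integrable g)
    (hk : Integrable k) :
    ∫ x, conv φ g x * 𝓕 k x = ∫ ξ, 𝓕 φ ξ * 𝓕 g ξ * k ξ := by
  have hconv : Integrable (conv φ g) := by
    rw [conv_eq_convolution]
    exact hφ.integrable_convolution _ hg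
  have hF (ξ : ℝ) : 𝓕 (conv φ g) ξ = 𝓕 φ ξ * 𝓕 g ξ := by
    rw [conv_eq_convolution, Real.fourier_mul_convolution_eq hφ hg]
  have hflip := VectorFourier.integral_fourierIntegral_smul_eq_flip (L := innerₗ ℝ)
    (μ := volume) (ν := volume) Real.continuous_fourierChar continuous_inner hconv hk
  simp_rw [← hF]
  rw [flip_innerₗ] at hflip
  exact hflip.symm

theorem integral_norm_mul_norm_le (f g : 𝓢(ℝ, ℂ)) :
    ∫ x, ‖f x‖ * ‖g x‖ ≤ ‖f.toLp 2‖ * ‖g.toLp 2‖ := by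
  have hnorm (f : 𝓢(ℝ, ℂ)) : ‖f.toLp 2‖ = (∫ x, ‖f x‖ ^ (2 : ℝ)) ^ (1 / (2 : ℝ)) := by
    rw [SchwartzMap.norm_toLp' (by simp) (by simp)]
    norm_num
  rw [hnorm, hnorm]
  exact integral_mul_norm_le_Lp_mul_Lq Real.HolderConjugate.two_two
    (by simpa using f.memLp 2) (by simpa using g.memLp 2)

theorem eLpNorm_conv_schwartz_le {φ : ℝ → ℂ} (hφ : Integrable φ) {M : ℝ}
    (hM : ∀ ξ, ‖𝓕 φ ξ‖ ≤ M) (g : 𝓢(ℝ, ℂ)) :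
    eLpNorm (conv φ g) 2 ≤ ENNReal.ofReal (M * ‖g.toLp 2‖) := by
  have hM0 : 0 ≤ M := (norm_nonneg _).trans (hM 0)
  refine eLpNorm_le_of_forall_schwartz (memLp_conv hφ (g.memLp 2))
    (mul_nonneg hM0 (norm_nonneg _)) fun s ↦ ?_
  obtain ⟨k, rfl⟩ : ∃ k : 𝓢(ℝ, ℂ), 𝓕 k = s := ⟨𝓕⁻ s, FourierTransform.fourier_fourierInv_eq s⟩
  have hint : Integrable fun ξ ↦ ‖(𝓕 g) ξ‖ * ‖k ξ‖ :=
    ((𝓕 g).memLp 2).norm.integrable_mul (k.memLp 2).norm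
  calc
    ‖∫ x, conv φ g x * (𝓕 k) x‖ ≤ ∫ ξ, M * (‖(𝓕 g) ξ‖ * ‖k ξ‖) := by
      rw [SchwartzMap.fourier_coe k, integral_conv_mul_fourier hφ g.integrable k.integrable,
        ← SchwartzMap.fourier_coe g]
      refine norm_integral_le_of_norm_le (hint.const_mul M) (.of_forall fun ξ ↦ ?_)
      rw [norm_mul, norm_mul, mul_assoc]
      exact mul_le_mul_of_nonneg_right (hM ξ) (by positivity)
    _ = M * ∫ ξ, ‖(𝓕 g) ξ‖ * ‖k ξ‖ := integral_const_mul _ _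
    _ ≤ M * (‖(𝓕 g).toLp 2 volume‖ * ‖k.toLp 2 volume‖) :=
      mul_le_mul_of_nonneg_left (integral_norm_mul_norm_le _ _) hM0
    _ = M * ‖g.toLp 2 volume‖ * ‖(𝓕 k).toLp 2 volume‖ := by
      rw [SchwartzMap.norm_fourier_toL2_eq, SchwartzMap.norm_fourier_toL2_eq, mul_assoc]

theorem ENNReal.le_of_forall_pos_le_add_mul {a b K : ℝ≥0∞} (hK : K ≠ ∞)
    (h : ∀ ε : ℝ, 0 < ε → a ≤ b + K * ENNReal.ofReal ε) : a ≤ b := by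
  have h0 : Filter.Tendsto ENNReal.ofReal (nhdsWithin 0 (Set.Ioi 0)) (nhds 0) := by
    simpa using (ENNReal.continuous_ofReal.tendsto 0).mono_left nhdsWithin_le_nhds
  have hlim := (ENNReal.Tendsto.const_mul h0 (.inr hK)).const_add b
  rw [mul_zero, add_zero] at hlim
  refine ge_of_tendsto hlim ?_
  filter_upwards [self_mem_nhdsWithin] with ε hε using h ε hε

theorem eLpNorm_conv_le_of_fourier_bound {φ g : ℝ → ℂ} (hφ : Integrable φ) (hg : MemLp g 2) {M : ℝ}
    (hM : ∀ ξ, ‖𝓕 φ ξ‖ ≤ M) :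
    eLpNorm (conv φ g) 2 ≤ ENNReal.ofReal M * eLpNorm g 2 := by
  have hM0 : 0 ≤ M := (norm_nonneg _).trans (hM 0)
  have hφ1 := (memLp_one_iff_integrable.2 hφ).2.ne
  refine ENNReal.le_of_forall_pos_le_add_mul (K := eLpNorm φ 1 volume + ENNReal.ofReal M)
    (ENNReal.add_ne_top.2 ⟨hφ1, ENNReal.ofReal_ne_top⟩) fun ε hε ↦ ?_
  obtain ⟨f, hf₁, hf₂, hf₃⟩ := hg.exist_eLpNorm_sub_le (by simp) one_le_two hε
  obtain ⟨s, rfl⟩ : ∃ s : 𝓢(ℝ, ℂ), ⇑s = f := ⟨hf₁.toSchwartzMap hf₂, rfl⟩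
  have hs2 := s.memLp 2 (volume : Measure ℝ)
  have hgs := memLp_conv hφ (hg.sub hs2)
  have hcs := memLp_conv hφ hs2
  calc
    eLpNorm (conv φ g) 2 volume = eLpNorm (conv φ (g - ⇑s) + conv φ s) 2 volume := by
      refine eLpNorm_congr_ae ?_
      filter_upwards [conv_sub_ae hφ hg hs2] with x hx
      simp [hx]
    _ ≤ eLpNorm (conv φ (g - ⇑s)) 2 volume + eLpNorm (conv φ s) 2 volume :=
      eLpNorm_add_le hgs.1 hcs.1 one_le_two
    _ ≤ eLpNorm φ 1 volume * eLpNorm (g - ⇑s) 2 volume + ENNReal.ofReal M * eLpNorm s 2 volume := by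
      gcongr
      · exact eLpNorm_conv_le hφ.1 (hg.sub hs2).1
      · refine (eLpNorm_conv_schwartz_le hφ hM s).trans_eq ?_
        rw [ENNReal.ofReal_mul hM0, SchwartzMap.norm_toLp, ENNReal.ofReal_toReal hs2.2.ne]
    _ ≤ eLpNorm φ 1 volume * ENNReal.ofReal ε +
        ENNReal.ofReal M * (eLpNorm g 2 volume + ENNReal.ofReal ε) := by
      gcongr
      calc
        eLpNorm s 2 volume = eLpNorm (g - (g - ⇑s)) 2 volume := by simp
        _ ≤ eLpNorm g 2 volume + eLpNorm (g - ⇑s) 2 volume :=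
          eLpNorm_sub_le hg.1 (hg.sub hs2).1 one_le_two
        _ ≤ _ := by gcongr
    _ = _ := by ring

theorem integral_norm_sq_conv_le {φ g : ℝ → ℂ} (hφ : Integrable φ) (hg : MemLp g 2) {M : ℝ}
    (hM : ∀ ξ, ‖𝓕 φ ξ‖ ≤ M) :
    ∫ x, ‖conv φ g x‖ ^ 2 ≤ M ^ 2 * ∫ x, ‖g x‖ ^ 2 := by
  have hM0 : 0 ≤ M := (norm_nonneg _).trans (hM 0)
  have toReal_sq {u : ℝ → ℂ} (hu : MemLp u 2) : ∫ x, ‖u x‖ ^ 2 = (eLpNorm u 2).toReal ^ 2 := by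
    rw [← ENNReal.toReal_pow, eLpNorm_two_sq, integral_eq_lintegral_of_nonneg_ae
      (.of_forall fun x ↦ sq_nonneg _) (hu.1.norm.aemeasurable.pow_const 2).aestronglyMeasurable]
    simp [ENNReal.ofReal_pow]
  rw [toReal_sq hg, toReal_sq (memLp_conv hφ hg), ← mul_pow]
  gcongr
  have := ENNReal.toReal_mono (ENNReal.mul_ne_top ENNReal.ofReal_ne_top hg.2.ne)
    (eLpNorm_conv_le_of_fourier_bound hφ hg hM)
  rwa [ENNReal.toReal_mul, ENNReal.toReal_ofReal hM0] at this

theorem conv_mul_exp (θ f : ℝ → ℂ) (s x : ℝ) :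
    conv (fun t ↦ θ t * Real.exp (s * t)) (fun t ↦ f t * Real.exp (s * t)) x =
      conv θ f x * Real.exp (s * x) := by
  simp only [conv]
  rw [← integral_mul_const]
  refine integral_congr_ae (.of_forall fun y ↦ ?_)
  have : Real.exp (s * x) = Real.exp (s * (x - y)) * Real.exp (s * y) := by
    rw [← Real.exp_add]; ring_nf
  simp only [this, ofReal_mul]
  ring

theorem norm_sq_mul_exp (z : ℂ) (s x : ℝ) :
    ‖z * (Real.exp (s * x) : ℂ)‖ ^ 2 = ‖z‖ ^ 2 * Real.exp (2 * s * x) := by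
  rw [norm_mul, mul_pow, norm_real, Real.norm_eq_abs, Real.abs_exp, ← Real.exp_nat_mul]
  push_cast
  ring_nf

theorem norm_sq_mul_cosh (z : ℂ) (β x : ℝ) :
    ‖z‖ ^ 2 * Real.cosh (β * x) = (‖z * (Real.exp (β / 2 * x) : ℂ)‖ ^ 2 +
      ‖z * (Real.exp (-(β / 2) * x) : ℂ)‖ ^ 2) / 2 := by
  rw [norm_sq_mul_exp, norm_sq_mul_exp, Real.cosh_eq]
  ring_nf

theorem aestronglyMeasurable_mul_exp {f : ℝ → ℂ} (hf : AEStronglyMeasurable f) (s : ℝ) :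
    AEStronglyMeasurable fun x ↦ f x * (Real.exp (s * x) : ℂ) :=
  hf.mul (by fun_prop : Continuous fun x : ℝ ↦ (Real.exp (s * x) : ℂ)).aestronglyMeasurable

theorem memLp_mul_exp {β s : ℝ} (hs : |s| = β / 2) {f : ℝ → ℂ} (hf : memE β f) :
    MemLp (fun x ↦ f x * (Real.exp (s * x) : ℂ)) 2 := by
  have hm := aestronglyMeasurable_mul_exp hf.1 s
  rw [memLp_two_iff_integrable_sq_norm hm]
  refine (hf.2.const_mul 2).mono' (hm.norm.aemeasurable.pow_const 2).aestronglyMeasurable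
    (.of_forall fun x ↦ ?_)
  rw [Real.norm_of_nonneg (sq_nonneg _), norm_sq_mul_cosh]
  have h₁ := sq_nonneg ‖f x * (Real.exp (β / 2 * x) : ℂ)‖
  have h₂ := sq_nonneg ‖f x * (Real.exp (-(β / 2) * x) : ℂ)‖
  rcases eq_or_eq_neg_of_abs_eq hs with rfl | rfl <;> linarith

theorem norm_mul_exp_le {β s : ℝ} (hs : |s| ≤ β / 2) (z : ℂ) (x : ℝ) :
    ‖z‖ * Real.exp (s * x) ≤ ‖z‖ * Real.exp (β * |x| / 2) := by
  gcongr
  calc s * x ≤ |s| * |x| := by rw [← abs_mul]; exact le_abs_self _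
    _ ≤ β / 2 * |x| := by gcongr
    _ = β * |x| / 2 := by ring

theorem integrable_mul_exp {β s : ℝ} (hs : |s| ≤ β / 2) {θ : ℝ → ℂ}
    (hθmeas : AEStronglyMeasurable θ)
    (hθint : Integrable fun x : ℝ ↦ ‖θ x‖ * Real.exp (β * |x| / 2)) :
    Integrable fun x ↦ θ x * (Real.exp (s * x) : ℂ) := by
  refine hθint.mono' (aestronglyMeasurable_mul_exp hθmeas s) (.of_forall fun x ↦ ?_)
  rw [norm_mul, norm_real, Real.norm_eq_abs, Real.abs_exp]
  exact norm_mul_exp_le hs _ x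

theorem fourier_mul_exp_eq_FTc (θ : ℝ → ℂ) (s ξ : ℝ) :
    𝓕 (fun x ↦ θ x * (Real.exp (s * x) : ℂ)) ξ = FTc θ (2 * Real.pi * ξ + s * I) := by
  rw [Real.fourier_eq', FTc]
  refine integral_congr_ae (.of_forall fun x ↦ ?_)
  simp only [smul_eq_mul, ofReal_exp]
  rw [mul_left_comm, ← Complex.exp_add]
  congr 2
  simp only [RCLike.inner_apply, conj_trivial]
  push_cast
  linear_combination (s * x : ℂ) * I_sq

theorem bddAbove_norm_FTc {β : ℝ} {θ : ℝ → ℂ}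
    (hθint : Integrable fun x : ℝ ↦ ‖θ x‖ * Real.exp (β * |x| / 2)) :
    BddAbove (Set.range fun z : {z : ℂ // |z.im| ≤ β / 2} ↦ ‖FTc θ z‖) := by
  refine ⟨∫ x, ‖θ x‖ * Real.exp (β * |x| / 2), ?_⟩
  rintro _ ⟨⟨z, hz⟩, rfl⟩
  refine norm_integral_le_of_norm_le hθint (.of_forall fun x ↦ ?_)
  rw [norm_mul, Complex.norm_exp]
  simpa using norm_mul_exp_le hz (θ x) x

/-- if `∫ |θ(x)| e^{β|x|/2} dx < ∞`, then for every `f ∈ ℰ` the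
convolution `θ*f` lies in `ℰ` and `‖θ*f‖_ω ≤ (sup_{|Im z| ≤ β/2} |θ̂(z)|) ‖f‖_ω`;
in particular the (linear) convolution operator `Θ` is bounded on `ℰ`. -/
theorem convolution_bounded (β : ℝ) (hβ : 0 < β) (θ : ℝ → ℂ)
    (hθmeas : AEStronglyMeasurable θ volume)
    (hθint : Integrable (fun x : ℝ => ‖θ x‖ * Real.exp (β * |x| / 2))) :
    ∀ f : ℝ → ℂ, memE β f →
      memE β (conv θ f) ∧
      normE β (conv θ f) ≤
        (⨆ z : {z : ℂ // |z.im| ≤ β / 2}, ‖FTc θ z‖) * normE β f := by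
  intro f hf
  set M := ⨆ z : {z : ℂ // |z.im| ≤ β / 2}, ‖FTc θ z‖
  have hM0 : 0 ≤ M := Real.iSup_nonneg fun _ ↦ norm_nonneg _
  have key (s : ℝ) (hs : |s| = β / 2) :
      MemLp (fun x ↦ conv θ f x * (Real.exp (s * x) : ℂ)) 2 ∧
        ∫ x, ‖conv θ f x * (Real.exp (s * x) : ℂ)‖ ^ 2 ≤
          M ^ 2 * ∫ x, ‖f x * (Real.exp (s * x) : ℂ)‖ ^ 2 := by
    have hθs := integrable_mul_exp hs.le hθmeas hθint
    have hfs := memLp_mul_exp hs hf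
    have hM (ξ : ℝ) : ‖𝓕 (fun x ↦ θ x * (Real.exp (s * x) : ℂ)) ξ‖ ≤ M := by
      rw [fourier_mul_exp_eq_FTc]
      exact le_ciSup (bddAbove_norm_FTc hθint)
        (⟨2 * Real.pi * ξ + s * I, by simp [hs]⟩ : {z : ℂ // |z.im| ≤ β / 2})
    simp_rw [← conv_mul_exp]
    exact ⟨memLp_conv hθs hfs, integral_norm_sq_conv_le hθs hfs hM⟩
  obtain ⟨hp, hp'⟩ := key (β / 2) (abs_of_pos (by positivity))
  obtain ⟨hn, hn'⟩ := key (-(β / 2)) (by rw [abs_neg, abs_of_pos (by positivity)])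
  have sq_int {u : ℝ → ℂ} (hu : MemLp u 2) : Integrable fun x ↦ ‖u x‖ ^ 2 :=
    (memLp_two_iff_integrable_sq_norm hu.1).1 hu
  have hfp := sq_int (memLp_mul_exp (abs_of_pos (by positivity)) hf)
  have hfn := sq_int (memLp_mul_exp (s := -(β / 2)) (by rw [abs_neg, abs_of_pos (by positivity)]) hf)
  refine ⟨⟨?_, ?_⟩, ?_⟩
  · convert aestronglyMeasurable_mul_exp hp.1 (-(β / 2)) using 2 with x
    rw [mul_assoc, ← ofReal_mul, ← Real.exp_add]
    simp
  · simp_rw [norm_sq_mul_cosh]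
    exact ((sq_int hp).add (sq_int hn)).div_const 2
  · rw [normE, normE, ← Real.sqrt_sq hM0, ← Real.sqrt_mul (sq_nonneg M)]
    refine Real.sqrt_le_sqrt ?_
    simp_rw [norm_sq_mul_cosh]
    rw [integral_div, integral_div, integral_add (sq_int hp) (sq_int hn), integral_add hfp hfn]
    linarith
end

section
/- Let θ : ℝ → ℂ be measurable with ∫_ℝ |θ(x)| e^{β|x|/2} dx < ∞ and ∫_ℝ θ(x) dx = 0, and let k ∈ ℕ₀. If f ∈ ℰ satisfies ∫_ℝ f(x) x^j dx = 0 for all 0 ≤ j ≤ k−1, then the convolution θ*f satisfies ∫_ℝ (θ*f)(x) x^j dx = 0 for all 0 ≤ j ≤ k. In other words, the convolution operator Θ : f ↦ θ*f maps ℰ_k into ℰ_{k+1}. -/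
open MeasureTheory Complex

theorem abs_pow_le_const_mul_exp {c : ℝ} (hc : 0 < c) (n : ℕ) (x : ℝ) :
    |x| ^ n ≤ n.factorial / c ^ n * Real.exp (c * |x|) := by
  have h := Real.pow_div_factorial_le_exp (x := c * |x|) (by positivity) n
  rw [div_le_iff₀ (by positivity), mul_pow] at h
  rw [div_mul_eq_mul_div, le_div_iff₀ (by positivity)]
  linarith

theorem integrable_mul_pow_of_integrable_norm_mul_exp {c : ℝ} (hc : 0 < c) {θ : ℝ → ℂ}
    (hθmeas : AEStronglyMeasurable θ volume)
    (hθint : Integrable (fun x : ℝ => ‖θ x‖ * Real.exp (c * |x|))) (n : ℕ) :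
    Integrable (fun x : ℝ => θ x * (x : ℂ) ^ n) := by
  refine (hθint.const_mul (n.factorial / c ^ n : ℝ)).mono'
    (hθmeas.mul (by fun_prop)) (.of_forall fun x => ?_)
  rw [norm_mul, norm_pow, norm_real, Real.norm_eq_abs, mul_left_comm]
  exact mul_le_mul_of_nonneg_left (abs_pow_le_const_mul_exp hc n x) (norm_nonneg _)

theorem pow_two_mul_div_cosh_le {β : ℝ} (hβ : 0 < β) (n : ℕ) :
    ∃ C : ℝ, ∀ x : ℝ, (|x| ^ n) ^ 2 / Real.cosh (β * x) ≤ C * (1 + x ^ 2)⁻¹ := by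
  refine ⟨2 * ((2 * n).factorial / β ^ (2 * n) + (2 * n + 2).factorial / β ^ (2 * n + 2)),
    fun x => ?_⟩
  have hexp : Real.exp (β * |x|) ≤ 2 * Real.cosh (β * x) := by
    rw [← Real.cosh_abs (β * x), abs_mul, abs_of_pos hβ, Real.cosh_eq]
    linarith [Real.exp_pos (-(β * |x|))]
  have h₁ := abs_pow_le_const_mul_exp hβ (2 * n) x
  have h₂ := abs_pow_le_const_mul_exp hβ (2 * n + 2) x
  have hx : (|x| ^ n) ^ 2 * (1 + x ^ 2) = |x| ^ (2 * n) + |x| ^ (2 * n + 2) := by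
    rw [← sq_abs x]; ring
  rw [← div_eq_mul_inv, div_le_div_iff₀ (Real.cosh_pos _) (by positivity), hx]
  calc _ ≤ ((2 * n).factorial / β ^ (2 * n) + (2 * n + 2).factorial / β ^ (2 * n + 2)) *
        Real.exp (β * |x|) := by linarith
    _ ≤ ((2 * n).factorial / β ^ (2 * n) + (2 * n + 2).factorial / β ^ (2 * n + 2)) *
        (2 * Real.cosh (β * x)) := by gcongr
    _ = _ := by ring

theorem memE.integrable_mul_pow {β : ℝ} (hβ : 0 < β) {f : ℝ → ℂ} (hf : memE β f) (n : ℕ) :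
    Integrable (fun x : ℝ => f x * (x : ℂ) ^ n) := by
  obtain ⟨C, hC⟩ := pow_two_mul_div_cosh_le hβ n
  refine (hf.2.add (integrable_inv_one_add_sq.const_mul C)).mono'
    (hf.1.mul (by fun_prop)) (.of_forall fun x => ?_)
  rw [norm_mul, norm_pow, norm_real, Real.norm_eq_abs]
  refine le_trans ?_ (add_le_add_right (hC x) _)
  have hc := Real.cosh_pos (β * x)
  set c := Real.cosh (β * x)
  set a := ‖f x‖
  set b := |x| ^ n
  have hab : 0 ≤ a * b := by positivity
  rw [← sub_nonneg]
  have : a ^ 2 * c + b ^ 2 / c - a * b = ((a * c - b) ^ 2 + a * b * c) / c := by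
    field_simp
    ring
  rw [this]
  positivity

open scoped Convolution in
theorem integral_conv_mul_pow {θ f : ℝ → ℂ} (hθ : ∀ n, Integrable (fun x : ℝ => θ x * (x : ℂ) ^ n))
    (hf : ∀ n, Integrable (fun x : ℝ => f x * (x : ℂ) ^ n)) (j : ℕ) :
    ∫ x : ℝ, conv θ f x * (x : ℂ) ^ j =
      ∑ m ∈ Finset.range (j + 1), (j.choose m : ℂ) *
        ((∫ x : ℝ, f x * (x : ℂ) ^ m) * ∫ x : ℝ, θ x * (x : ℂ) ^ (j - m)) := by
  let L := ContinuousLinearMap.mul ℝ ℂ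
  have hpt : ∀ᵐ x : ℝ, conv θ f x * (x : ℂ) ^ j =
      ∑ m ∈ Finset.range (j + 1), (j.choose m : ℂ) *
        ((fun x : ℝ => f x * (x : ℂ) ^ m) ⋆[L] fun x : ℝ => θ x * (x : ℂ) ^ (j - m)) x := by
    have hex := ae_all_iff.2 fun m : ℕ =>
      (hf m).ae_convolution_exists L (hθ (j - m))
    filter_upwards [hex] with x hx
    simp_rw [convolution_def, ← integral_const_mul]
    rw [conv, ← integral_mul_const, ← integral_finsetSum _ fun m _ => (hx m).const_mul _]
    congr 1 with y
    have hxy : (x : ℂ) = y + ((x - y : ℝ) : ℂ) := by push_cast; ring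
    rw [hxy, add_pow, Finset.mul_sum]
    refine Finset.sum_congr rfl fun m _ => ?_
    simp only [L, ContinuousLinearMap.mul_apply']
    ring
  rw [integral_congr_ae hpt, integral_finsetSum _ fun m _ =>
    ((hf m).integrable_convolution L (hθ (j - m))).const_mul _]
  refine Finset.sum_congr rfl fun m _ => ?_
  rw [integral_const_mul, integral_convolution L (hf m) (hθ (j - m))]
  rfl

/-- if `θ` has zero mean and `∫ |θ| e^{β|x|/2} dx < ∞`, and if
`f ∈ ℰ` has vanishing moments of orders `0,…,k−1`, then `θ*f` has vanishing
moments of orders `0,…,k`; i.e. `Θ : ℰ_k → ℰ_{k+1}`. -/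
theorem convolution_raises_moments (β : ℝ) (hβ : 0 < β) (θ : ℝ → ℂ)
    (hθmeas : AEStronglyMeasurable θ volume)
    (hθint : Integrable (fun x : ℝ => ‖θ x‖ * Real.exp (β * |x| / 2)))
    (hθmass : ∫ x : ℝ, θ x = 0) (k : ℕ) :
    ∀ f : ℝ → ℂ, memE β f → (∀ j < k, ∫ x : ℝ, f x * (x : ℂ) ^ j = 0) →
      ∀ j < k + 1, ∫ x : ℝ, conv θ f x * (x : ℂ) ^ j = 0 := by
  intro f hf hmom j hj
  have hθ := integrable_mul_pow_of_integrable_norm_mul_exp (half_pos hβ) hθmeas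
    (by simpa only [div_mul_eq_mul_div] using hθint)
  rw [integral_conv_mul_pow hθ (hf.integrable_mul_pow hβ)]
  refine Finset.sum_eq_zero fun m hm => ?_
  obtain hlt | rfl := (Nat.lt_succ_iff.1 (Finset.mem_range.1 hm)).lt_or_eq
  · simp [hmom m (by omega)]
  · simp [hθmass]
end

section
/- Let θ : ℝ → ℂ be a function with distributional derivative θ' such that ∫_ℝ |θ(x)| e^{β|x|/2} dx < ∞, ∫_ℝ |θ'(x)| e^{β|x|/2} dx < ∞ and ∫_ℝ θ(x) dx = 0. Then: (a) the function θ̂(z) = ∫_ℝ θ(x) e^{−izx} dx is analytic on the strip Ω_{β/2} = {z ∈ ℂ : |Im z| < β/2} and sup_{z ∈ Ω_{β/2}} |θ̂(z)| < ∞; (b) θ̂(0) = 0; and (c) sup_{z ∈ Ω_{β/2}} |∫_0^1 θ̂(zs)/s ds| < ∞. In particular θ satisfies the conditions (C) of the paper for this β. -/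
open MeasureTheory Complex
open scoped ContDiff

/-- `f'` is the distributional derivative of `f`. -/
def IsDistribDeriv (f f' : ℝ → ℂ) : Prop :=
  ∀ φ : ℝ → ℂ, ContDiff ℝ ∞ φ → HasCompactSupport φ →
    ∫ x : ℝ, f x * deriv φ x = -∫ x : ℝ, f' x * φ x

/-- The open strip `Ω_{β/2} = {z : |Im z| < β/2}`. -/
def strip (β : ℝ) : Set ℂ := {z : ℂ | |z.im| < β / 2}

/-- Smooth compactly supported cutoffs converging to `1`, with derivatives converging to `0`. -/
lemma exists_cutoff_seq : ∃ (χ : ℕ → ℝ → ℂ) (K : ℝ), (∀ n, ContDiff ℝ ∞ (χ n)) ∧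
    (∀ n, HasCompactSupport (χ n)) ∧ (∀ n x, ‖χ n x‖ ≤ 1) ∧ (∀ n x, ‖deriv (χ n) x‖ ≤ K) ∧
    (∀ x, Filter.Tendsto (χ · x) Filter.atTop (nhds 1)) ∧
    ∀ x, Filter.Tendsto (fun n => deriv (χ n) x) Filter.atTop (nhds 0) := by
  obtain ⟨b⟩ : Nonempty (ContDiffBump (0 : ℝ)) := inferInstance
  obtain ⟨f, hf⟩ : ∃ f : ℝ → ℂ, f = fun x => ((b x : ℝ) : ℂ) := ⟨_, rfl⟩
  have hf_smooth : ContDiff ℝ ∞ f := hf ▸ Complex.ofRealCLM.contDiff.comp b.contDiff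
  have hf_supp : HasCompactSupport f :=
    hf ▸ b.hasCompactSupport.comp_left (g := fun r : ℝ => (r : ℂ)) Complex.ofReal_zero
  have hf_zero : f 0 = 1 := by
    simp [hf, b.one_of_mem_closedBall (Metric.mem_closedBall_self b.rIn_pos.le)]
  have hf_norm : ∀ x, ‖f x‖ ≤ 1 := fun x => by
    rw [hf, Complex.norm_real, Real.norm_of_nonneg b.nonneg]
    exact b.le_one
  have hdf : Continuous (deriv f) := hf_smooth.continuous_deriv (by simp)
  obtain ⟨K, hK⟩ := hf_supp.deriv.exists_bound_of_continuous hdf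
  obtain ⟨c, -, hc_mem, hc⟩ := exists_seq_strictAnti_tendsto' (zero_lt_one (α := ℝ))
  have hcx : ∀ x, Filter.Tendsto (fun n => c n * x) Filter.atTop (nhds 0) := fun x => by
    simpa using hc.mul_const x
  have hderiv : ∀ n x, deriv (fun x => f (c n * x)) x = c n • deriv f (c n * x) :=
    fun n x => deriv_comp_mul_left (c n) f x
  refine ⟨fun n x => f (c n * x), K, fun n => hf_smooth.comp (contDiff_const.mul contDiff_id),
    fun n => ?_, fun n x => hf_norm _, fun n x => ?_, fun x => ?_, fun x => ?_⟩
  · exact hf_supp.comp_homeomorph (Homeomorph.mulLeft₀ (c n) (hc_mem n).1.ne')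
  · rw [hderiv, norm_smul, Real.norm_of_nonneg (hc_mem n).1.le]
    exact (mul_le_of_le_one_left (norm_nonneg _) (hc_mem n).2.le).trans (hK _)
  · simpa [hf_zero, Function.comp_def] using (hf_smooth.continuous.tendsto 0).comp (hcx x)
  · simpa [hderiv, Function.comp_def] using hc.smul ((hdf.tendsto 0).comp (hcx x))

/-- Integration by parts against a smooth function, not necessarily compactly supported, for
which all the products involved are integrable. -/
lemma IsDistribDeriv.integral_mul_deriv {f f' g : ℝ → ℂ} (h : IsDistribDeriv f f')
    (hg : ContDiff ℝ ∞ g) (hfg : Integrable fun x => f x * g x)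
    (hfdg : Integrable fun x => f x * deriv g x) (hf'g : Integrable fun x => f' x * g x) :
    ∫ x, f x * deriv g x = -∫ x, f' x * g x := by
  obtain ⟨χ, K, hχ, hχ_supp, hχ_norm, hdχ_norm, hχ_lim, hdχ_lim⟩ := exists_cutoff_seq
  have hcut : ∀ n, ∫ x, (f x * g x * deriv (χ n) x + f x * deriv g x * χ n x)
      = -∫ x, f' x * g x * χ n x := by
    intro n
    have hd : ∀ x, deriv (fun x => χ n x * g x) x = deriv (χ n) x * g x + χ n x * deriv g x :=
      fun x => deriv_fun_mul ((hχ n).differentiable (by simp) x) (hg.differentiable (by simp) x)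
    have := h _ ((hχ n).mul hg) (hχ_supp n).mul_right
    calc _ = ∫ x, f x * deriv (fun x => χ n x * g x) x :=
          integral_congr_ae (.of_forall fun x => by simp only [hd]; ring)
      _ = _ := this
      _ = _ := congrArg _ (integral_congr_ae (.of_forall fun x => by ring))
  have hleft : Filter.Tendsto
      (fun n => ∫ x, (f x * g x * deriv (χ n) x + f x * deriv g x * χ n x)) Filter.atTop
      (nhds (∫ x, f x * deriv g x)) := by
    refine tendsto_integral_of_dominated_convergence
      (fun x => ‖f x * g x‖ * K + ‖f x * deriv g x‖) (fun n => ?_)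
      ((hfg.norm.mul_const K).add hfdg.norm) (fun n => .of_forall fun x => ?_)
      (.of_forall fun x => ?_)
    · exact (hfg.aestronglyMeasurable.mul
        ((hχ n).continuous_deriv (by simp)).aestronglyMeasurable).add
        (hfdg.aestronglyMeasurable.mul (hχ n).continuous.aestronglyMeasurable)
    · refine (norm_add_le _ _).trans (add_le_add ?_ ?_) <;> rw [norm_mul]
      · exact mul_le_mul_of_nonneg_left (hdχ_norm n x) (norm_nonneg _)
      · exact mul_le_of_le_one_right (norm_nonneg _) (hχ_norm n x)
    · simpa using ((hdχ_lim x).const_mul (f x * g x)).add ((hχ_lim x).const_mul (f x * deriv g x))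
  have hright : Filter.Tendsto (fun n => -∫ x, f' x * g x * χ n x) Filter.atTop
      (nhds (-∫ x, f' x * g x)) := by
    refine (tendsto_integral_of_dominated_convergence (fun x => ‖f' x * g x‖)
      (fun n => hf'g.aestronglyMeasurable.mul (hχ n).continuous.aestronglyMeasurable)
      hf'g.norm (fun n => .of_forall fun x => ?_) (.of_forall fun x => ?_)).neg
    · exact (norm_mul_le _ _).trans (mul_le_of_le_one_right (norm_nonneg _) (hχ_norm n x))
    · simpa using (hχ_lim x).const_mul (f' x * g x)
  exact tendsto_nhds_unique (by simpa only [hcut] using hleft) hright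

lemma norm_exp_neg_I_mul (z : ℂ) (x : ℝ) :
    ‖Complex.exp (-(Complex.I * z * x))‖ = Real.exp (z.im * x) := by
  simp [Complex.norm_exp]

lemma norm_exp_neg_I_mul_le {a : ℝ} {z : ℂ} (hz : |z.im| ≤ a) (x : ℝ) :
    ‖Complex.exp (-(Complex.I * z * x))‖ ≤ Real.exp (a * |x|) := by
  rw [norm_exp_neg_I_mul, Real.exp_le_exp]
  exact (le_abs_self _).trans (by rw [abs_mul]; gcongr)

lemma integrable_mul_exp_neg_I_mul {β : ℝ} {θ : ℝ → ℂ} (hθmeas : AEStronglyMeasurable θ volume)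
    (hθint : Integrable (fun x : ℝ => ‖θ x‖ * Real.exp (β * |x| / 2))) {z : ℂ}
    (hz : z ∈ strip β) : Integrable fun x : ℝ => θ x * Complex.exp (-(Complex.I * z * x)) := by
  refine hθint.mono' (hθmeas.mul (Continuous.aestronglyMeasurable (by fun_prop))) ?_
  filter_upwards with x
  rw [norm_mul]
  gcongr
  exact (norm_exp_neg_I_mul_le (le_of_lt hz) x).trans_eq (by ring_nf)

lemma norm_FTc_le {β : ℝ} {θ : ℝ → ℂ}
    (hθint : Integrable (fun x : ℝ => ‖θ x‖ * Real.exp (β * |x| / 2))) {z : ℂ}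
    (hz : z ∈ strip β) : ‖FTc θ z‖ ≤ ∫ x : ℝ, ‖θ x‖ * Real.exp (β * |x| / 2) := by
  refine norm_integral_le_of_norm_le hθint ?_
  filter_upwards with x
  rw [norm_mul]
  gcongr
  exact (norm_exp_neg_I_mul_le (le_of_lt hz) x).trans_eq (by ring_nf)

/-- The factor `|x|` is absorbed by an arbitrarily small exponential weight. -/
lemma abs_mul_exp_le {a b : ℝ} (hab : a < b) (x : ℝ) :
    |x| * Real.exp (a * |x|) ≤ (b - a)⁻¹ * Real.exp (b * |x|) := by
  have hba : 0 < b - a := sub_pos.2 hab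
  have h1 : (b - a) * |x| ≤ Real.exp ((b - a) * |x|) := by
    linarith [Real.add_one_le_exp ((b - a) * |x|)]
  have h2 : Real.exp (b * |x|) = Real.exp ((b - a) * |x|) * Real.exp (a * |x|) := by
    rw [← Real.exp_add]; ring_nf
  rw [h2, ← mul_assoc]
  gcongr
  rw [inv_mul_eq_div, le_div_iff₀ hba, mul_comm]
  exact h1

lemma differentiableOn_FTc {β : ℝ} {θ : ℝ → ℂ} (hθmeas : AEStronglyMeasurable θ volume)
    (hθint : Integrable (fun x : ℝ => ‖θ x‖ * Real.exp (β * |x| / 2))) :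
    DifferentiableOn ℂ (FTc θ) (strip β) := by
  intro z hz
  obtain ⟨a, hza, haβ⟩ := exists_between (show |z.im| < β / 2 from hz)
  have hs : {w : ℂ | |w.im| < a} ∈ nhds z :=
    (isOpen_lt (by fun_prop) continuous_const).mem_nhds hza
  have hmeas : ∀ w : ℂ, AEStronglyMeasurable
      (fun x : ℝ => θ x * Complex.exp (-(Complex.I * w * x))) volume := fun w =>
    hθmeas.mul (Continuous.aestronglyMeasurable (by fun_prop))
  refine (hasDerivAt_integral_of_dominated_loc_of_deriv_le
    (F := fun (w : ℂ) (x : ℝ) => θ x * Complex.exp (-(Complex.I * w * x)))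
    (F' := fun (w : ℂ) (x : ℝ) =>
      θ x * (Complex.exp (-(Complex.I * w * x)) * (-(Complex.I * x))))
    (bound := fun x => (β / 2 - a)⁻¹ * (‖θ x‖ * Real.exp (β * |x| / 2)))
    hs (.of_forall hmeas) (integrable_mul_exp_neg_I_mul hθmeas hθint hz)
    (hθmeas.mul (Continuous.aestronglyMeasurable (by fun_prop)))
    (.of_forall fun x w hw => ?_) (hθint.const_mul _)
    (.of_forall fun x w _ => ?_)).2.differentiableAt.differentiableWithinAt
  · calc ‖θ x * (Complex.exp (-(Complex.I * w * x)) * (-(Complex.I * x)))‖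
        = ‖θ x‖ * (|x| * ‖Complex.exp (-(Complex.I * w * x))‖) := by
          simp only [norm_mul, norm_neg, Complex.norm_I, Complex.norm_real, Real.norm_eq_abs]
          ring
      _ ≤ ‖θ x‖ * ((β / 2 - a)⁻¹ * Real.exp (β / 2 * |x|)) := by
          refine mul_le_mul_of_nonneg_left ?_ (norm_nonneg _)
          exact (mul_le_mul_of_nonneg_left (norm_exp_neg_I_mul_le (le_of_lt hw) x)
            (abs_nonneg x)).trans (abs_mul_exp_le haβ x)
      _ = _ := by ring_nf
  · refine (HasDerivAt.cexp ?_).const_mul (θ x)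
    simpa using (((hasDerivAt_id w).const_mul Complex.I).mul_const (x : ℂ)).fun_neg

/-- Near the origin, the Fourier transform of a function of zero mean is `O(z)`. -/
lemma norm_FTc_le_mul_norm {β : ℝ} (hβ : 0 < β) {θ : ℝ → ℂ}
    (hθmeas : AEStronglyMeasurable θ volume)
    (hθint : Integrable (fun x : ℝ => ‖θ x‖ * Real.exp (β * |x| / 2)))
    (hθ0 : FTc θ 0 = 0) {z : ℂ} (hz : ‖z‖ ≤ β / 4) :
    ‖FTc θ z‖ ≤ (β / 4)⁻¹ * (∫ x : ℝ, ‖θ x‖ * Real.exp (β * |x| / 2)) * ‖z‖ := by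
  have hmem : ∀ w : ℂ, ‖w‖ ≤ β / 4 → w ∈ strip β := fun w hw =>
    ((Complex.abs_im_le_norm w).trans hw).trans_lt (by linarith)
  have hdiff : FTc θ z = ∫ x : ℝ, (θ x * Complex.exp (-(Complex.I * z * x))
      - θ x * Complex.exp (-(Complex.I * (0 : ℂ) * x))) := by
    rw [integral_sub (integrable_mul_exp_neg_I_mul hθmeas hθint (hmem z hz))
      (integrable_mul_exp_neg_I_mul hθmeas hθint (hmem 0 (by simpa using by positivity)))]
    change FTc θ z = FTc θ z - FTc θ 0
    rw [hθ0, sub_zero]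
  rw [hdiff, mul_right_comm, ← integral_const_mul]
  refine norm_integral_le_of_norm_le (hθint.const_mul _) (.of_forall fun x => ?_)
  have hexp : ‖Complex.exp (-(Complex.I * z * x)) - 1‖
      ≤ ‖z‖ * ((β / 4)⁻¹ * Real.exp (β / 2 * |x|)) := by
    have hn : ‖-(Complex.I * z * x)‖ = ‖z‖ * |x| := by simp
    have h1 : ‖Complex.exp (-(Complex.I * z * x)) - 1‖
        ≤ ‖z‖ * |x| * Real.exp (‖z‖ * |x|) := by
      simpa [hn] using Complex.norm_exp_sub_sum_le_norm_mul_exp (-(Complex.I * z * x)) 1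
    calc _ ≤ ‖z‖ * |x| * Real.exp (‖z‖ * |x|) := h1
      _ ≤ ‖z‖ * (|x| * Real.exp (β / 4 * |x|)) := by rw [mul_assoc]; gcongr
      _ ≤ ‖z‖ * ((β / 4)⁻¹ * Real.exp (β / 2 * |x|)) := by
        have := abs_mul_exp_le (show β / 4 < β / 2 by linarith) x
        rw [show β / 2 - β / 4 = β / 4 by ring] at this
        gcongr
  calc _ = ‖θ x‖ * ‖Complex.exp (-(Complex.I * z * x)) - 1‖ := by
        rw [← norm_mul]; simp [mul_sub]
    _ ≤ ‖θ x‖ * (‖z‖ * ((β / 4)⁻¹ * Real.exp (β / 2 * |x|))) := by gcongr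
    _ = _ := by ring_nf

lemma FTc_distribDeriv {β : ℝ} {θ θ' : ℝ → ℂ} (hθmeas : AEStronglyMeasurable θ volume)
    (hθ'meas : AEStronglyMeasurable θ' volume) (hderiv : IsDistribDeriv θ θ')
    (hθint : Integrable (fun x : ℝ => ‖θ x‖ * Real.exp (β * |x| / 2)))
    (hθ'int : Integrable (fun x : ℝ => ‖θ' x‖ * Real.exp (β * |x| / 2))) {z : ℂ}
    (hz : z ∈ strip β) : FTc θ' z = Complex.I * z * FTc θ z := by
  have hd : ∀ x : ℝ, HasDerivAt (fun x : ℝ => Complex.exp (-(Complex.I * z * x)))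
      (Complex.exp (-(Complex.I * z * x)) * -(Complex.I * z)) x := fun x => by
    refine HasDerivAt.cexp ?_
    simpa using ((hasDerivAt_id x).ofReal_comp.const_mul (Complex.I * z)).fun_neg
  have hsm : ContDiff ℝ ∞ (fun x : ℝ => Complex.exp (-(Complex.I * z * x))) :=
    (contDiff_const.mul Complex.ofRealCLM.contDiff).neg.cexp
  have hi := integrable_mul_exp_neg_I_mul hθmeas hθint hz
  have h := hderiv.integral_mul_deriv hsm hi
    (by
      simp only [(hd _).deriv, ← mul_assoc]
      exact hi.mul_const _)
    (integrable_mul_exp_neg_I_mul hθ'meas hθ'int hz)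
  simp only [(hd _).deriv, ← mul_assoc, integral_mul_const] at h
  change FTc θ z * _ = -FTc θ' z at h
  linear_combination h

lemma integral_div_one_add_sq_le (r : ℝ) :
    ∫ s in (0 : ℝ)..1, r / (1 + (r * s) ^ 2) ≤ Real.pi / 2 := by
  have hd : ∀ s ∈ Set.uIcc (0 : ℝ) 1,
      HasDerivAt (fun s => Real.arctan (r * s)) (r / (1 + (r * s) ^ 2)) s := fun s _ => by
    have := ((hasDerivAt_id s).const_mul r).arctan
    simpa [div_eq_inv_mul] using this
  rw [intervalIntegral.integral_eq_sub_of_hasDerivAt hd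
    (Continuous.intervalIntegrable
      (continuous_const.div (by fun_prop) fun s => by positivity) _ _)]
  simpa using (Real.arctan_lt_pi_div_two r).le

/-- A function vanishing to first order at the origin and decaying like `1 / |z|` along rays
has bounded logarithmic averages. -/
lemma norm_integral_div_le {F : ℂ → ℂ} {K : ℝ} (hK : 0 ≤ K) {z : ℂ}
    (h : ∀ s ∈ Set.Ioc (0 : ℝ) 1, (1 + ‖z * s‖ ^ 2) * ‖F (z * s)‖ ≤ K * ‖z * s‖) :
    ‖∫ s in (0 : ℝ)..1, F (z * s) / s‖ ≤ K * (Real.pi / 2) := by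
  have hint : IntervalIntegrable (fun s : ℝ => K * (‖z‖ / (1 + (‖z‖ * s) ^ 2))) volume 0 1 :=
    (continuous_const.mul (continuous_const.div (by fun_prop)
      fun s => by positivity)).intervalIntegrable _ _
  refine (intervalIntegral.norm_integral_le_of_norm_le zero_le_one
    (.of_forall fun s hs => ?_) hint).trans ?_
  · have hs0 : 0 < s := hs.1
    have hzs : ‖z * (s : ℂ)‖ = ‖z‖ * s := by simp [abs_of_pos hs0]
    have := h s hs
    rw [hzs] at this
    rw [norm_div, Complex.norm_real, Real.norm_of_nonneg hs0.le, div_le_iff₀ hs0,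
      mul_div_assoc', div_mul_eq_mul_div, le_div_iff₀ (by positivity)]
    linarith
  · rw [intervalIntegral.integral_const_mul]
    exact mul_le_mul_of_nonneg_left (integral_div_one_add_sq_le _) hK

/-- if `θ ∈ W^{1,1}(e^{β|x|/2})` has zero mean, then
(a) `θ̂` is analytic and bounded on the strip `Ω_{β/2}`, (b) `θ̂(0) = 0`, and
(c) `z ↦ ∫_0^1 θ̂(zs)/s ds` is bounded on `Ω_{β/2}`; i.e. `θ` satisfies (C). -/
theorem sufficient_conditions_for_C (β : ℝ) (hβ : 0 < β) (θ θ' : ℝ → ℂ)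
    (hθmeas : AEStronglyMeasurable θ volume)
    (hθ'meas : AEStronglyMeasurable θ' volume)
    (hderiv : IsDistribDeriv θ θ')
    (hθint : Integrable (fun x : ℝ => ‖θ x‖ * Real.exp (β * |x| / 2)))
    (hθ'int : Integrable (fun x : ℝ => ‖θ' x‖ * Real.exp (β * |x| / 2)))
    (hθmass : ∫ x : ℝ, θ x = 0) :
    DifferentiableOn ℂ (FTc θ) (strip β) ∧
    (∃ C : ℝ, ∀ z ∈ strip β, ‖FTc θ z‖ ≤ C) ∧
    FTc θ 0 = 0 ∧
    (∃ C : ℝ, ∀ z ∈ strip β, ‖∫ s in (0:ℝ)..1, FTc θ (z * s) / s‖ ≤ C) := by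
  have hθ0 : FTc θ 0 = 0 := by simpa [FTc] using hθmass
  refine ⟨differentiableOn_FTc hθmeas hθint, ⟨_, fun z hz => norm_FTc_le hθint hz⟩, hθ0, ?_⟩
  set M := ∫ x : ℝ, ‖θ x‖ * Real.exp (β * |x| / 2)
  set M' := ∫ x : ℝ, ‖θ' x‖ * Real.exp (β * |x| / 2)
  have hM : 0 ≤ M := integral_nonneg fun x => by positivity
  have hM' : 0 ≤ M' := integral_nonneg fun x => by positivity
  set δ := β / 4
  have hδ : 0 < δ := by positivity
  set K := (1 + δ ^ 2) * (δ⁻¹ * M) + (1 + (δ ^ 2)⁻¹) * M'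
  have hbound : ∀ w ∈ strip β, (1 + ‖w‖ ^ 2) * ‖FTc θ w‖ ≤ K * ‖w‖ := by
    intro w hw
    rcases le_total ‖w‖ δ with hwδ | hwδ
    · calc (1 + ‖w‖ ^ 2) * ‖FTc θ w‖ ≤ (1 + δ ^ 2) * (δ⁻¹ * M * ‖w‖) := by
            gcongr
            exact norm_FTc_le_mul_norm hβ hθmeas hθint hθ0 hwδ
        _ = (1 + δ ^ 2) * (δ⁻¹ * M) * ‖w‖ := by ring
        _ ≤ K * ‖w‖ := by
            gcongr
            exact le_add_of_nonneg_right (by positivity)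
    · have hdecay : ‖w‖ * ‖FTc θ w‖ ≤ M' := by
        have := norm_FTc_le hθ'int hw
        rw [FTc_distribDeriv hθmeas hθ'meas hderiv hθint hθ'int hw] at this
        simpa using this
      have hone : 1 ≤ (δ ^ 2)⁻¹ * ‖w‖ ^ 2 := by
        rw [inv_mul_eq_div, one_le_div (by positivity)]
        gcongr
      calc (1 + ‖w‖ ^ 2) * ‖FTc θ w‖
          ≤ ((δ ^ 2)⁻¹ * ‖w‖ ^ 2 + ‖w‖ ^ 2) * ‖FTc θ w‖ := by gcongr
        _ = (1 + (δ ^ 2)⁻¹) * (‖w‖ * ‖FTc θ w‖) * ‖w‖ := by ring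
        _ ≤ (1 + (δ ^ 2)⁻¹) * M' * ‖w‖ := by gcongr
        _ ≤ K * ‖w‖ := by
            gcongr
            exact le_add_of_nonneg_left (by positivity)
  refine ⟨K * (Real.pi / 2), fun z hz => norm_integral_div_le (by positivity) fun s hs => ?_⟩
  refine hbound _ ((?_ : _ ≤ |z.im|).trans_lt hz)
  rw [Complex.im_mul_ofReal, abs_mul, abs_of_pos hs.1]
  exact mul_le_of_le_one_right (abs_nonneg _) hs.2
end

section
/- Let θ : ℝ → ℂ be measurable with ∫_ℝ |θ(x)| e^{β|x|/2} dx < ∞. Let f ∈ ℰ with ∫_ℝ f(x) dx = 0 and define F(x) = ∫_{−∞}^x f(y) dy. Then: (i) F ∈ ℰ and ‖F‖_ω ≤ C_β ‖f‖_ω with a constant C_β depending only on β; (ii) θ*F = ∫_{−∞}^x (θ*f)(y) dy, i.e. convolution commutes with the antiderivative on massless functions; (iii) if moreover ζ ∈ ℂ and 𝔏f + θ*f = ζf in the distributional sense, then 𝔏F + θ*F = (ζ+1)F in the distributional sense. -/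
open MeasureTheory Complex
open scoped ContDiff

/-- `𝔏 f + θ*f = ζ f` in the distributional sense. -/
def PerturbedEigenEq (θ : ℝ → ℂ) (ζ : ℂ) (f : ℝ → ℂ) : Prop :=
  ∀ φ : ℝ → ℂ, ContDiff ℝ ∞ φ → HasCompactSupport φ →
    (∫ x : ℝ, f x * (deriv (deriv φ) x - x * deriv φ x))
      + (∫ x : ℝ, conv θ f x * φ x) = ζ * ∫ x : ℝ, f x * φ x

/-- The antiderivative `x ↦ ∫_{-∞}^x f`. -/
noncomputable def primitive (f : ℝ → ℂ) (x : ℝ) : ℂ := ∫ y in Set.Iic x, f y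

theorem integrable_exp_neg_mul_abs {c : ℝ} (hc : 0 < c) :
    Integrable (fun x : ℝ => Real.exp (-(c * |x|))) := by
  rw [← integrableOn_univ, ← Set.Iic_union_Ioi (a := (0 : ℝ))]
  refine IntegrableOn.union ?_ ?_
  · refine (integrableOn_exp_mul_Iic hc 0).congr_fun (fun x hx => ?_) measurableSet_Iic
    simp [abs_of_nonpos (Set.mem_Iic.1 hx)]
  · refine (integrableOn_exp_mul_Ioi (neg_lt_zero.2 hc) 0).congr_fun (fun x hx => ?_)
      measurableSet_Ioi
    simp [abs_of_pos (Set.mem_Ioi.1 hx)]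

theorem cosh_le_exp_abs (x : ℝ) : Real.cosh x ≤ Real.exp |x| := by
  rw [← Real.cosh_abs, Real.cosh_eq]
  have : Real.exp (-|x|) ≤ Real.exp |x| := Real.exp_le_exp.2 (by linarith [abs_nonneg x])
  linarith

theorem exp_abs_le_two_mul_cosh (x : ℝ) : Real.exp |x| ≤ 2 * Real.cosh x := by
  rw [Real.cosh_eq]
  linarith [Real.exp_abs_le x]

theorem memE.integrable_norm_mul_exp {β : ℝ} (hβ : 0 < β) {f : ℝ → ℂ} (hf : memE β f) :
    Integrable (fun x : ℝ => ‖f x‖ * Real.exp (β / 4 * |x|)) := by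
  refine ((hf.2.const_mul 2).add (integrable_exp_neg_mul_abs (half_pos hβ))).mono'
    (hf.1.norm.mul (by fun_prop)) (Filter.Eventually.of_forall fun x => ?_)
  have h1 := exp_abs_le_two_mul_cosh (β * x)
  rw [abs_mul, abs_of_pos hβ] at h1
  set a := Real.exp (β / 4 * |x|) with ha
  have h0 : 0 < a := Real.exp_pos _
  have e1 : Real.exp (β * |x|) = a ^ 4 := by
    rw [ha, ← Real.exp_nat_mul]; congr 1; push_cast; ring
  have e2 : Real.exp (-(β / 2 * |x|)) = (a ^ 2)⁻¹ := by
    rw [ha, ← Real.exp_nat_mul, ← Real.exp_neg]; congr 1; push_cast; ring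
  simp only [Pi.add_apply, e2]
  rw [Real.norm_of_nonneg (by positivity)]
  have e3 : ‖f x‖ * a = (‖f x‖ * a ^ 2) * a⁻¹ := by field_simp
  have e4 : ‖f x‖ ^ 2 * a ^ 4 ≤ 2 * (‖f x‖ ^ 2 * Real.cosh (β * x)) := by
    rw [e1] at h1
    nlinarith [sq_nonneg ‖f x‖]
  rw [e3, ← inv_pow]
  nlinarith [sq_nonneg (‖f x‖ * a ^ 2 - a⁻¹), sq_nonneg (‖f x‖ * a ^ 2), sq_nonneg a⁻¹]

theorem memE.integrable {β : ℝ} (hβ : 0 < β) {f : ℝ → ℂ} (hf : memE β f) : Integrable f := by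
  refine (hf.integrable_norm_mul_exp hβ).mono' hf.1 (Filter.Eventually.of_forall fun x => ?_)
  exact le_mul_of_one_le_right (norm_nonneg _) (Real.one_le_exp (by positivity))

theorem memE.integrable_mul_ofReal {β : ℝ} (hβ : 0 < β) {f : ℝ → ℂ} (hf : memE β f) :
    Integrable (fun x : ℝ => f x * (x : ℂ)) := by
  refine ((hf.integrable_norm_mul_exp hβ).const_mul (4 / β)).mono' (hf.1.mul (by fun_prop))
    (Filter.Eventually.of_forall fun x => ?_)
  have h : |x| ≤ 4 / β * Real.exp (β / 4 * |x|) := by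
    have := Real.add_one_le_exp (β / 4 * |x|)
    calc |x| = 4 / β * (β / 4 * |x|) := by field_simp
      _ ≤ _ := by gcongr; linarith
  rw [norm_mul, norm_real, Real.norm_eq_abs, mul_left_comm]
  gcongr

theorem integrable_of_integrable_norm_mul_exp {β : ℝ} (hβ : 0 < β) {θ : ℝ → ℂ}
    (hθ : AEStronglyMeasurable θ volume)
    (h : Integrable (fun x : ℝ => ‖θ x‖ * Real.exp (β * |x| / 2))) : Integrable θ := by
  refine h.mono' hθ (Filter.Eventually.of_forall fun x => ?_)
  exact le_mul_of_one_le_right (norm_nonneg _) (Real.one_le_exp (by positivity))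

theorem continuous_primitive_Iic {f : ℝ → ℂ} (hf : Integrable f) : Continuous (primitive f) := by
  have : primitive f = fun x => primitive f 0 + ∫ y in (0 : ℝ)..x, f y := by
    ext x
    have := intervalIntegral.integral_Iic_sub_Iic (μ := volume) (f := f) (a := 0) (b := x)
      hf.integrableOn hf.integrableOn
    simp only [primitive]
    rw [← this]; ring
  rw [this]
  exact continuous_const.add
    (intervalIntegral.continuous_primitive (fun _ _ => hf.intervalIntegrable) 0)

theorem integral_mul_eq_neg_integral_primitive_mul_deriv {f g : ℝ → ℂ} (hf : Integrable f)
    (hg : ContDiff ℝ 1 g) (hgc : HasCompactSupport g) :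
    ∫ x, f x * g x = -∫ x, primitive f x * deriv g x := by
  have hg' : Integrable (deriv g) :=
    (hg.continuous_deriv le_rfl).integrable_of_hasCompactSupport hgc.deriv
  have hint : Integrable (Function.uncurry fun x y : ℝ =>
      (Set.Iic x).indicator f y * deriv g x) (volume.prod volume) := by
    have h := (hg'.mul_prod hf).indicator
      (measurableSet_le measurable_snd measurable_fst : MeasurableSet {p : ℝ × ℝ | p.2 ≤ p.1})
    refine h.congr (Filter.Eventually.of_forall fun p => ?_)
    by_cases hp : p.2 ≤ p.1 <;> simp [Function.uncurry, Set.indicator, hp, mul_comm]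
  have hswap := integral_integral_swap hint
  have e1 : ∀ x, ∫ y, (Set.Iic x).indicator f y * deriv g x = primitive f x * deriv g x := by
    intro x
    rw [integral_mul_const, integral_indicator measurableSet_Iic, primitive]
  have e2 : ∀ y, ∫ x, (Set.Iic x).indicator f y * deriv g x = -(f y * g y) := by
    intro y
    have : ∀ x, (Set.Iic x).indicator f y * deriv g x
        = (Set.Ici y).indicator (fun x => f y * deriv g x) x := by
      intro x
      by_cases hp : y ≤ x <;> simp [Set.indicator, hp]
    simp_rw [this]
    rw [integral_indicator measurableSet_Ici, integral_Ici_eq_integral_Ioi, integral_const_mul,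
      hgc.integral_Ioi_deriv_eq hg, mul_neg]
  simp_rw [e1, e2] at hswap
  rw [hswap, integral_neg, neg_neg]

theorem integrable_conv_integrand {θ f : ℝ → ℂ} (hθ : Integrable θ) (hf : Integrable f) :
    Integrable (fun p : ℝ × ℝ => θ (p.1 - p.2) * f p.2) (volume.prod volume) := by
  have h := Integrable.convolution_integrand (ContinuousLinearMap.mul ℝ ℂ) hf hθ
    (μ := (volume : Measure ℝ)) (ν := (volume : Measure ℝ))
  simpa [mul_comm] using h

theorem integrable_conv {θ f : ℝ → ℂ} (hθ : Integrable θ) (hf : Integrable f) :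
    Integrable (conv θ f) :=
  (integrable_conv_integrand hθ hf).integral_prod_left

theorem conv_eq_integral_sub (θ f : ℝ → ℂ) (x : ℝ) : conv θ f x = ∫ z, θ z * f (x - z) := by
  rw [conv, ← integral_sub_left_eq_self _ volume x]
  simp

theorem primitive_comp_sub (f : ℝ → ℂ) (x z : ℝ) :
    primitive f (x - z) = ∫ u in Set.Iic x, f (u - z) := by
  rw [primitive, ← integral_indicator measurableSet_Iic, ← integral_indicator measurableSet_Iic,
    ← integral_sub_right_eq_self _ z]
  congr with u
  by_cases h : u ≤ x <;> simp [Set.indicator, h]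

theorem conv_primitive {θ f : ℝ → ℂ} (hθ : Integrable θ) (hf : Integrable f) (x : ℝ) :
    conv θ (primitive f) x = primitive (conv θ f) x := by
  have hint : Integrable (Function.uncurry fun u z : ℝ => θ z * f (u - z))
      (volume.prod volume) := by
    have h := Integrable.convolution_integrand (ContinuousLinearMap.mul ℝ ℂ) hθ hf
      (μ := (volume : Measure ℝ)) (ν := (volume : Measure ℝ))
    simpa [Function.uncurry_def] using h
  have hint' : Integrable (Function.uncurry fun u z : ℝ => θ z * f (u - z))
      ((volume.restrict (Set.Iic x)).prod volume) :=
    hint.mono_measure (Measure.prod_mono Measure.restrict_le_self le_rfl)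
  rw [conv_eq_integral_sub, primitive]
  simp_rw [conv_eq_integral_sub, primitive_comp_sub, ← integral_const_mul]
  rw [integral_integral_swap hint']

theorem sq_lintegral_mul_le {k h : ℝ → ENNReal} (hk : AEMeasurable k) (hh : AEMeasurable h) :
    (∫⁻ y, k y * h y) ^ 2 ≤ (∫⁻ y, k y) * ∫⁻ y, k y * h y ^ 2 := by
  have hroot : ∀ y, k y ^ (1 / 2 : ℝ) * k y ^ (1 / 2 : ℝ) = k y := fun y => by
    rw [← ENNReal.rpow_add_of_nonneg _ _ (by norm_num) (by norm_num)]; norm_num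
  have hsq : ∀ a : ENNReal, (a ^ (1 / 2 : ℝ)) ^ 2 = a := fun a => by
    rw [← ENNReal.rpow_natCast, ← ENNReal.rpow_mul]; norm_num
  have hCS := ENNReal.lintegral_mul_le_Lp_mul_Lq volume Real.HolderConjugate.two_two
    (hk.pow_const (1 / 2 : ℝ)) ((hk.pow_const (1 / 2 : ℝ)).mul hh)
  simp only [Pi.mul_apply, ← mul_assoc, hroot, ENNReal.rpow_two, mul_pow, hsq] at hCS
  calc _ ≤ _ := pow_le_pow_left' hCS 2
    _ = _ := by rw [mul_pow, hsq, hsq]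

theorem lintegral_sq_convolution_le {k h : ℝ → ENNReal} (hk : Measurable k)
    (hh : AEMeasurable h) :
    ∫⁻ x, (∫⁻ y, k (x - y) * h y) ^ 2 ≤ (∫⁻ y, k y) ^ 2 * ∫⁻ y, h y ^ 2 := by
  calc ∫⁻ x, (∫⁻ y, k (x - y) * h y) ^ 2
      ≤ ∫⁻ x, (∫⁻ y, k y) * ∫⁻ y, k (x - y) * h y ^ 2 := by
        refine lintegral_mono fun x => ?_
        rw [← lintegral_sub_left_eq_self k x]
        exact sq_lintegral_mul_le (by fun_prop) hh
    _ = (∫⁻ y, k y) * ∫⁻ y, ∫⁻ x, k (x - y) * h y ^ 2 := by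
        have hm : AEMeasurable (Function.uncurry fun x y : ℝ => k (x - y) * h y ^ 2)
            (volume.prod volume) :=
          AEMeasurable.mul (by fun_prop) ((hh.pow_const 2).comp_snd)
        have hm' : AEMeasurable fun x => ∫⁻ y, k (x - y) * h y ^ 2 := hm.lintegral_prod_right'
        rw [lintegral_const_mul'' _ hm', lintegral_lintegral_swap hm]
    _ = _ := by
        have : ∀ y, ∫⁻ x, k (x - y) * h y ^ 2 = (∫⁻ x, k x) * h y ^ 2 := fun y => by
          rw [lintegral_mul_const _ (by fun_prop), lintegral_sub_right_eq_self]
        simp_rw [this]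
        rw [lintegral_const_mul'' _ (hh.pow_const 2), ← mul_assoc, sq]

theorem enorm_primitive_mul_exp_le {c : ℝ} {f : ℝ → ℂ} (hf : Integrable f)
    (hf0 : ∫ x, f x = 0) (x : ℝ) :
    ‖primitive f x‖ₑ * ENNReal.ofReal (Real.exp (c * |x|)) ≤
      ∫⁻ y, ENNReal.ofReal (Real.exp (-(c * |x - y|))) *
        (‖f y‖ₑ * ENNReal.ofReal (Real.exp (c * |y|))) := by
  obtain ⟨S, hS, hFS, hxS⟩ : ∃ S : Set ℝ, MeasurableSet S ∧
      ‖primitive f x‖ₑ ≤ ∫⁻ y in S, ‖f y‖ₑ ∧ ∀ y ∈ S, |x| = -|x - y| + |y| := by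
    rcases le_total x 0 with hx | hx
    · refine ⟨Set.Iic x, measurableSet_Iic, enorm_integral_le_lintegral_enorm _, fun y hy => ?_⟩
      have hy : y ≤ x := hy
      rw [abs_of_nonpos hx, abs_of_nonneg (sub_nonneg.2 hy), abs_of_nonpos (hy.trans hx)]
      ring
    · refine ⟨Set.Ioi x, measurableSet_Ioi, ?_, fun y hy => ?_⟩
      · have h := intervalIntegral.integral_Iic_add_Ioi (b := x) hf.integrableOn hf.integrableOn
        rw [hf0] at h
        rw [primitive, eq_neg_of_add_eq_zero_left h, enorm_neg]
        exact enorm_integral_le_lintegral_enorm _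
      · have hy : x < y := hy
        rw [abs_of_nonneg hx, abs_of_neg (sub_neg.2 hy), abs_of_pos (hx.trans_lt hy)]
        ring
  calc _ ≤ (∫⁻ y in S, ‖f y‖ₑ) * ENNReal.ofReal (Real.exp (c * |x|)) := by gcongr
    _ = ∫⁻ y in S, ‖f y‖ₑ * ENNReal.ofReal (Real.exp (c * |x|)) :=
        (lintegral_mul_const' _ _ ENNReal.ofReal_ne_top).symm
    _ = ∫⁻ y in S, ENNReal.ofReal (Real.exp (-(c * |x - y|))) *
        (‖f y‖ₑ * ENNReal.ofReal (Real.exp (c * |y|))) := by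
        refine setLIntegral_congr_fun hS fun y hy => ?_
        have : Real.exp (c * |x|) = Real.exp (-(c * |x - y|)) * Real.exp (c * |y|) := by
          rw [← Real.exp_add]
          congr 1
          linear_combination c * hxS y hy
        simp only [this, ENNReal.ofReal_mul (Real.exp_nonneg _)]
        ring
    _ ≤ _ := setLIntegral_le_lintegral _ _

theorem enorm_mul_exp_sq (z : ℂ) (β x : ℝ) :
    (‖z‖ₑ * ENNReal.ofReal (Real.exp (β / 2 * |x|))) ^ 2 =
      ENNReal.ofReal (‖z‖ ^ 2 * Real.exp (β * |x|)) := by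
  rw [← ofReal_norm, ← ENNReal.ofReal_mul (norm_nonneg _), ← ENNReal.ofReal_pow
    (by positivity), mul_pow, ← Real.exp_nat_mul]
  congr 3
  push_cast
  ring

theorem memE_primitive_and_normE_le {β : ℝ} (hβ : 0 < β) {f : ℝ → ℂ} (hf : memE β f)
    (hf0 : ∫ x, f x = 0) :
    memE β (primitive f) ∧ normE β (primitive f) ≤
      (2 * ∫ y : ℝ, Real.exp (-(β / 2 * |y|))) * normE β f := by
  have hfi := hf.integrable hβ
  set K := ∫ y : ℝ, Real.exp (-(β / 2 * |y|)) with hK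
  have hK0 : 0 ≤ K := integral_nonneg fun _ => Real.exp_nonneg _
  set N := ∫ x : ℝ, ‖f x‖ ^ 2 * Real.cosh (β * x) with hN
  have hnn : ∀ (g : ℝ → ℂ) (x : ℝ), 0 ≤ ‖g x‖ ^ 2 * Real.cosh (β * x) := fun g x =>
    mul_nonneg (sq_nonneg _) (Real.cosh_pos _).le
  have hN0 : 0 ≤ N := integral_nonneg (hnn f)
  have hKl : ∫⁻ y : ℝ, ENNReal.ofReal (Real.exp (-(β / 2 * |y|))) = ENNReal.ofReal K :=
    (ofReal_integral_eq_lintegral_ofReal (integrable_exp_neg_mul_abs (half_pos hβ))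
      (Filter.Eventually.of_forall fun _ => Real.exp_nonneg _)).symm
  have habs : ∀ x : ℝ, |β * x| = β * |x| := fun x => by rw [abs_mul, abs_of_pos hβ]
  have hFm : AEStronglyMeasurable (primitive f) volume :=
    (continuous_primitive_Iic hfi).aestronglyMeasurable
  have hbound : ∫⁻ x, ENNReal.ofReal (‖primitive f x‖ ^ 2 * Real.cosh (β * x)) ≤
      ENNReal.ofReal (K ^ 2 * (2 * N)) := by
    calc ∫⁻ x, ENNReal.ofReal (‖primitive f x‖ ^ 2 * Real.cosh (β * x))
        ≤ ∫⁻ x, (‖primitive f x‖ₑ * ENNReal.ofReal (Real.exp (β / 2 * |x|))) ^ 2 := by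
          refine lintegral_mono fun x => ?_
          rw [enorm_mul_exp_sq, ← habs]
          gcongr
          exact cosh_le_exp_abs _
      _ ≤ ∫⁻ x, (∫⁻ y, ENNReal.ofReal (Real.exp (-(β / 2 * |x - y|))) *
            (‖f y‖ₑ * ENNReal.ofReal (Real.exp (β / 2 * |y|)))) ^ 2 :=
          lintegral_mono fun x => pow_le_pow_left' (enorm_primitive_mul_exp_le hfi hf0 x) 2
      _ ≤ ENNReal.ofReal K ^ 2 *
            ∫⁻ y, (‖f y‖ₑ * ENNReal.ofReal (Real.exp (β / 2 * |y|))) ^ 2 := by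
          rw [← hKl]
          exact lintegral_sq_convolution_le
            (k := fun y => ENNReal.ofReal (Real.exp (-(β / 2 * |y|)))) (by fun_prop)
            (hf.1.enorm.mul (by fun_prop))
      _ ≤ ENNReal.ofReal K ^ 2 *
            ∫⁻ y, ENNReal.ofReal (2 * (‖f y‖ ^ 2 * Real.cosh (β * y))) := by
          gcongr with y
          rw [enorm_mul_exp_sq, ← habs, mul_left_comm]
          gcongr
          exact exp_abs_le_two_mul_cosh _
      _ = _ := by
          rw [← ofReal_integral_eq_lintegral_ofReal (hf.2.const_mul 2)
            (Filter.Eventually.of_forall fun x => mul_nonneg zero_le_two (hnn f x)),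
            integral_const_mul, ← ENNReal.ofReal_pow hK0, ← ENNReal.ofReal_mul (by positivity)]
  have hmeas : AEStronglyMeasurable (fun x => ‖primitive f x‖ ^ 2 * Real.cosh (β * x)) volume :=
    (hFm.norm.pow 2).mul
      (Real.continuous_cosh.comp (continuous_const.mul continuous_id)).aestronglyMeasurable
  refine ⟨⟨hFm, hmeas, ?_⟩, ?_⟩
  · rw [hasFiniteIntegral_iff_ofReal (Filter.Eventually.of_forall (hnn _))]
    exact hbound.trans_lt ENNReal.ofReal_lt_top
  · have h : ∫ x, ‖primitive f x‖ ^ 2 * Real.cosh (β * x) ≤ K ^ 2 * (2 * N) := by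
      rw [integral_eq_lintegral_of_nonneg_ae (Filter.Eventually.of_forall (hnn _)) hmeas]
      exact ENNReal.toReal_le_of_le_ofReal (by positivity) hbound
    refine Real.sqrt_le_iff.2 ⟨mul_nonneg (by positivity) (Real.sqrt_nonneg _), h.trans ?_⟩
    rw [normE, mul_pow, Real.sq_sqrt hN0]
    nlinarith [mul_nonneg (sq_nonneg K) hN0]

theorem HasCompactSupport.comp_sub_const {g : ℝ → ℂ} (hg : HasCompactSupport g) (a : ℝ) :
    HasCompactSupport fun x => g (x - a) :=
  hg.comp_homeomorph (Homeomorph.subRight a)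

theorem Continuous.integrable_mul_of_hasCompactSupport {G h : ℝ → ℂ} (hh : Continuous h)
    (hG : Integrable G) (hhc : HasCompactSupport h) : Integrable fun x => G x * h x := by
  obtain ⟨M, hM⟩ := hhc.exists_bound_of_continuous hh
  exact hG.mul_bdd hh.aestronglyMeasurable (Filter.Eventually.of_forall hM)

theorem tendsto_integral_mul_comp_sub_atTop {G h : ℝ → ℂ} (hG : Integrable G)
    (hh : Continuous h) (hhc : HasCompactSupport h) :
    Filter.Tendsto (fun n : ℕ => ∫ x, G x * h (x - n)) Filter.atTop (nhds 0) := by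
  obtain ⟨M, hM⟩ := hhc.exists_bound_of_continuous hh
  rw [← integral_zero ℝ ℂ (μ := volume)]
  refine tendsto_integral_of_dominated_convergence (fun x => ‖G x‖ * M)
    (fun n => hG.1.mul (by fun_prop)) (hG.norm.mul_const M)
    (fun n => Filter.Eventually.of_forall fun x => ?_)
    (Filter.Eventually.of_forall fun x => ?_)
  · rw [norm_mul]
    exact mul_le_mul_of_nonneg_left (hM _) (norm_nonneg _)
  · obtain ⟨R, hR⟩ := hhc.isCompact.isBounded.subset_closedBall 0
    refine tendsto_const_nhds.congr' ?_
    filter_upwards [Filter.eventually_gt_atTop ⌈|x| + R⌉₊] with n hn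
    have hn : |x| + R < n := Nat.lt_of_ceil_lt hn
    have hx : x - n ∉ tsupport h := fun hx => by
      have h := hR hx
      rw [mem_closedBall_zero_iff, Real.norm_eq_abs] at h
      linarith [neg_abs_le (x - n), le_abs_self x]
    rw [image_eq_zero_of_notMem_tsupport hx, mul_zero]

theorem deriv_sub_comp_sub_const {g : ℝ → ℂ} (hg : Differentiable ℝ g) (a : ℝ) :
    deriv (fun x => g x - g (x - a)) = fun x => deriv g x - deriv g (x - a) := by
  ext x
  have hd : DifferentiableAt ℝ (fun x => g (x - a)) x := by fun_prop
  rw [deriv_fun_sub (hg x) hd, deriv_comp_sub_const]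

/-- The difference of a test function and its translate is the derivative of a test function. -/
theorem exists_deriv_eq_sub_comp_sub {ψ : ℝ → ℂ} (hψ : ContDiff ℝ ∞ ψ)
    (hψc : HasCompactSupport ψ) (n : ℕ) :
    ∃ φ : ℝ → ℂ, ContDiff ℝ ∞ φ ∧ HasCompactSupport φ ∧
      deriv φ = fun x => ψ x - ψ (x - n) := by
  have hcont := hψ.continuous
  set Φ : ℝ → ℂ := fun x => ∫ y in (0 : ℝ)..x, ψ y with hΦ
  have hd : ∀ x, HasDerivAt Φ (ψ x) x := fun x =>
    intervalIntegral.integral_hasDerivAt_right (hcont.intervalIntegrable _ _)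
      (hcont.stronglyMeasurableAtFilter _ _) hcont.continuousAt
  have hdiff : Differentiable ℝ Φ := fun x => (hd x).differentiableAt
  have hderiv : deriv Φ = ψ := funext fun x => (hd x).deriv
  have hsm : ContDiff ℝ ∞ Φ := contDiff_infty_iff_deriv.2 ⟨hdiff, by rwa [hderiv]⟩
  obtain ⟨R, hR⟩ := hψc.isCompact.isBounded.subset_closedBall 0
  refine ⟨fun x => Φ x - Φ (x - n), hsm.sub (hsm.comp (contDiff_id.sub contDiff_const)),
    HasCompactSupport.intro (isCompact_Icc (a := -R) (b := R + n)) fun x hx => ?_, ?_⟩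
  · rw [hΦ, intervalIntegral.integral_interval_sub_left (hcont.intervalIntegrable _ _)
      (hcont.intervalIntegrable _ _)]
    refine intervalIntegral.integral_zero_ae (Filter.Eventually.of_forall fun y hy => ?_)
    refine image_eq_zero_of_notMem_tsupport fun hys => hx ?_
    have h := hR hys
    rw [mem_closedBall_zero_iff, Real.norm_eq_abs, abs_le] at h
    rw [Set.uIoc_of_le (sub_le_self _ n.cast_nonneg)] at hy
    exact ⟨by linarith [hy.2], by linarith [hy.1]⟩
  · rw [deriv_sub_comp_sub_const hdiff, hderiv]

/-- The distribution `𝔏F + T - λF` applied to `ψ`, split into its four pairings. -/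
noncomputable def eigenPairing (F T : ℝ → ℂ) (μ : ℂ) (ψ : ℝ → ℂ) : ℂ :=
  (∫ x, F x * deriv (deriv ψ) x) - (∫ x : ℝ, F x * (x : ℂ) * deriv ψ x) + (∫ x, T x * ψ x)
    - μ * ∫ x, F x * ψ x

theorem integral_mul_sub_mul_deriv {F : ℝ → ℂ} (hF : Integrable F)
    (hxF : Integrable fun x : ℝ => F x * (x : ℂ)) {ψ : ℝ → ℂ} (hψ : ContDiff ℝ ∞ ψ)
    (hψc : HasCompactSupport ψ) :
    ∫ x : ℝ, F x * (deriv (deriv ψ) x - x * deriv ψ x) =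
      (∫ x, F x * deriv (deriv ψ) x) - ∫ x : ℝ, F x * (x : ℂ) * deriv ψ x := by
  have h1 : ContDiff ℝ ∞ (deriv ψ) := (contDiff_infty_iff_deriv.1 hψ).2
  have h2 : ContDiff ℝ ∞ (deriv (deriv ψ)) := (contDiff_infty_iff_deriv.1 h1).2
  rw [← integral_sub (h2.continuous.integrable_mul_of_hasCompactSupport hF hψc.deriv.deriv)
    (h1.continuous.integrable_mul_of_hasCompactSupport hxF hψc.deriv)]
  congr with x
  ring

theorem integral_mul_sub_comp_sub {G h : ℝ → ℂ} (hG : Integrable G) (hh : Continuous h)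
    (hhc : HasCompactSupport h) (a : ℝ) :
    ∫ x, G x * (h x - h (x - a)) = (∫ x, G x * h x) - ∫ x, G x * h (x - a) := by
  have hh' : Continuous fun x => h (x - a) := by fun_prop
  rw [← integral_sub (hh.integrable_mul_of_hasCompactSupport hG hhc)
    (hh'.integrable_mul_of_hasCompactSupport hG (hhc.comp_sub_const a))]
  simp_rw [mul_sub]

/-- An eigenvalue equation that holds against derivatives of test functions holds against all
test functions, since the functions involved are integrable. -/
theorem eigenPairing_eq_zero {F T : ℝ → ℂ} {μ : ℂ} (hF : Integrable F)
    (hxF : Integrable fun x : ℝ => F x * (x : ℂ)) (hT : Integrable T)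
    (h : ∀ φ : ℝ → ℂ, ContDiff ℝ ∞ φ → HasCompactSupport φ → eigenPairing F T μ (deriv φ) = 0)
    {ψ : ℝ → ℂ} (hψ : ContDiff ℝ ∞ ψ) (hψc : HasCompactSupport ψ) :
    eigenPairing F T μ ψ = 0 := by
  have h1 : ContDiff ℝ ∞ (deriv ψ) := (contDiff_infty_iff_deriv.1 hψ).2
  have h2 : ContDiff ℝ ∞ (deriv (deriv ψ)) := (contDiff_infty_iff_deriv.1 h1).2
  have d0 : Differentiable ℝ ψ := (contDiff_infty_iff_deriv.1 hψ).1
  have d1 : Differentiable ℝ (deriv ψ) := (contDiff_infty_iff_deriv.1 h1).1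
  have key : ∀ n : ℕ, (∫ x, F x * deriv (deriv ψ) (x - n))
      - (∫ x : ℝ, F x * (x : ℂ) * deriv ψ (x - n)) + (∫ x, T x * ψ (x - n))
      - μ * (∫ x, F x * ψ (x - n)) = eigenPairing F T μ ψ := fun n => by
    obtain ⟨φ, hφ, hφc, hφd⟩ := exists_deriv_eq_sub_comp_sub hψ hψc n
    have h0 := h φ hφ hφc
    rw [eigenPairing, hφd, deriv_sub_comp_sub_const d0, deriv_sub_comp_sub_const d1,
      integral_mul_sub_comp_sub hF h2.continuous hψc.deriv.deriv,
      integral_mul_sub_comp_sub hxF h1.continuous hψc.deriv,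
      integral_mul_sub_comp_sub hT hψ.continuous hψc,
      integral_mul_sub_comp_sub hF hψ.continuous hψc] at h0
    rw [eigenPairing]
    linear_combination -h0
  have hlim := (((tendsto_integral_mul_comp_sub_atTop hF h2.continuous hψc.deriv.deriv).sub
    (tendsto_integral_mul_comp_sub_atTop hxF h1.continuous hψc.deriv)).add
    (tendsto_integral_mul_comp_sub_atTop hT hψ.continuous hψc)).sub
    ((tendsto_integral_mul_comp_sub_atTop hF hψ.continuous hψc).const_mul μ)
  simp_rw [key] at hlim
  simpa using tendsto_nhds_unique tendsto_const_nhds hlim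

theorem perturbedEigenEq_primitive {θ f : ℝ → ℂ} {ζ : ℂ} (hθ : Integrable θ)
    (hf : Integrable f) (hF : Integrable (primitive f))
    (hxF : Integrable fun x : ℝ => primitive f x * (x : ℂ)) (h : PerturbedEigenEq θ ζ f) :
    PerturbedEigenEq θ (ζ + 1) (primitive f) := by
  intro ψ hψ hψc
  have hpair : eigenPairing (primitive f) (conv θ (primitive f)) (ζ + 1) ψ = 0 := by
    refine eigenPairing_eq_zero hF hxF (integrable_conv hθ hF) (fun φ hφ hφc => ?_) hψ hψc
    have h1 : ContDiff ℝ ∞ (deriv φ) := (contDiff_infty_iff_deriv.1 hφ).2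
    have h2 : ContDiff ℝ ∞ (deriv (deriv φ)) := (contDiff_infty_iff_deriv.1 h1).2
    have d1 : Differentiable ℝ (deriv φ) := (contDiff_infty_iff_deriv.1 h1).1
    have d2 : Differentiable ℝ (deriv (deriv φ)) := (contDiff_infty_iff_deriv.1 h2).1
    have hsm : ContDiff ℝ ∞ fun x : ℝ => deriv (deriv φ) x - x * deriv φ x :=
      h2.sub (ofRealCLM.contDiff.mul h1)
    have hsc : HasCompactSupport fun x : ℝ => deriv (deriv φ) x - x * deriv φ x :=
      hφc.deriv.deriv.sub hφc.deriv.mul_left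
    have hd : ∀ x : ℝ, deriv (fun x : ℝ => deriv (deriv φ) x - x * deriv φ x) x =
        (deriv (deriv (deriv φ)) x - x * deriv (deriv φ) x) - deriv φ x := fun x => by
      have := ((d2 x).hasDerivAt.sub
        ((ofRealCLM.hasDerivAt (x := x)).mul (d1 x).hasDerivAt)).deriv
      simp only [ofRealCLM_apply, ofReal_one, one_mul] at this
      refine Eq.trans this ?_
      ring
    have e := h φ hφ hφc
    have hle : (1 : WithTop ℕ∞) ≤ ∞ := by exact_mod_cast le_top
    rw [integral_mul_eq_neg_integral_primitive_mul_deriv hf (hsm.of_le hle) hsc,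
      integral_mul_eq_neg_integral_primitive_mul_deriv hf (hφ.of_le hle) hφc,
      integral_mul_eq_neg_integral_primitive_mul_deriv (integrable_conv hθ hf) (hφ.of_le hle)
        hφc] at e
    simp_rw [hd, ← conv_primitive hθ hf] at e
    have hLint : Integrable fun x : ℝ => primitive f x *
        (deriv (deriv (deriv φ)) x - x * deriv (deriv φ) x) :=
      Continuous.integrable_mul_of_hasCompactSupport
        ((h2.continuous_deriv hle).sub (continuous_ofReal.mul h2.continuous)) hF
        (hφc.deriv.deriv.deriv.sub hφc.deriv.deriv.mul_left)
    have hsplit : ∫ x : ℝ, primitive f x *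
        ((deriv (deriv (deriv φ)) x - x * deriv (deriv φ) x) - deriv φ x) =
        (∫ x : ℝ, primitive f x * (deriv (deriv (deriv φ)) x - x * deriv (deriv φ) x)) -
          ∫ x, primitive f x * deriv φ x := by
      rw [← integral_sub hLint
        (h1.continuous.integrable_mul_of_hasCompactSupport hF hφc.deriv)]
      simp_rw [mul_sub]
    rw [hsplit, integral_mul_sub_mul_deriv hF hxF h1 hφc.deriv] at e
    rw [eigenPairing]
    linear_combination -e
  rw [eigenPairing] at hpair
  rw [integral_mul_sub_mul_deriv hF hxF hψ hψc]
  linear_combination hpair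

/-- annihilation operator: for `f ∈ ℰ` massless and
`F(x) = ∫_{−∞}^x f`, one has (i) `F ∈ ℰ` with `‖F‖_ω ≤ C_β ‖f‖_ω`,
(ii) `θ*F` is the antiderivative of `θ*f`, and (iii) if `𝔏f + θ*f = ζf`
then `𝔏F + θ*F = (ζ+1)F` (distributionally). -/
theorem annihilation_operator (β : ℝ) (hβ : 0 < β) :
    ∃ C : ℝ, 0 < C ∧
      ∀ θ : ℝ → ℂ, AEStronglyMeasurable θ volume →
        Integrable (fun x : ℝ => ‖θ x‖ * Real.exp (β * |x| / 2)) →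
      ∀ f : ℝ → ℂ, memE β f → (∫ x : ℝ, f x) = 0 →
        (memE β (fun x => ∫ y in Set.Iic x, f y) ∧
          normE β (fun x => ∫ y in Set.Iic x, f y) ≤ C * normE β f) ∧
        (∀ᵐ x : ℝ ∂volume,
          conv θ (fun x' => ∫ y in Set.Iic x', f y) x = ∫ y in Set.Iic x, conv θ f y) ∧
        (∀ ζ : ℂ, PerturbedEigenEq θ ζ f →
          PerturbedEigenEq θ (ζ + 1) (fun x => ∫ y in Set.Iic x, f y)) := by

  refine ⟨2 * (∫ y : ℝ, Real.exp (-(β / 2 * |y|))) + 1, ?_, fun θ hθm hθe f hf hf0 => ?_⟩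
  · have : 0 ≤ ∫ y : ℝ, Real.exp (-(β / 2 * |y|)) := integral_nonneg fun _ => Real.exp_nonneg _
    positivity
  have hθ := integrable_of_integrable_norm_mul_exp hβ hθm hθe
  have hfi := hf.integrable hβ
  obtain ⟨hF, hle⟩ := memE_primitive_and_normE_le hβ hf hf0
  refine ⟨⟨hF, hle.trans ?_⟩, Filter.Eventually.of_forall (conv_primitive hθ hfi), fun ζ h =>
    perturbedEigenEq_primitive hθ hfi (hF.integrable hβ) (hF.integrable_mul_ofReal hβ) h⟩
  exact mul_le_mul_of_nonneg_right (by linarith) (Real.sqrt_nonneg _)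
end
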